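/- Assume that for every Y ∈ ℳ_p the matrices A_1 Y, …, A_m Y are linearly independent, and let R ≥ 0 be such that trace(X) ≤ R for every X ∈ 𝒞. Let Y ∈ ℳ_p and ε_g, ε_H ≥ 0 be such that ‖2 S(Y) Y‖ ≤ ε_g (Frobenius norm) and S(Y) + (ε_H/2) I_n is positive semidefinite. Then for every X' ∈ 𝒞, 2(⟨C, YYᵀ⟩ − ⟨C, X'⟩) ≤ ε_H R + ε_g √R. Moreover, if the identity matrix I_n lies in the range of 𝒜*, then the stronger bound 2(⟨C, YYᵀ⟩ − ⟨C, X'⟩) ≤ ε_H R holds for every X' ∈ 𝒞. -/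

import Mathlib

open Matrix MeasureTheory

noncomputable section

/-- Frobenius inner product ⟨A,B⟩ = trace(AᵀB). -/
def ip {n p : ℕ} (A B : Matrix (Fin n) (Fin p) ℝ) : ℝ := Matrix.trace (Aᵀ * B)

/-- The constraint map 𝒜(X)ᵢ = trace(Aᵢ X). -/
def calA {n m : ℕ} (A : Fin m → Matrix (Fin n) (Fin n) ℝ) (X : Matrix (Fin n) (Fin n) ℝ) :
    Fin m → ℝ := fun i => Matrix.trace (A i * X)

/-- The adjoint 𝒜*(ν) = ∑ νᵢ Aᵢ. -/
def adjA {n m : ℕ} (A : Fin m → Matrix (Fin n) (Fin n) ℝ) (ν : Fin m → ℝ) :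
    Matrix (Fin n) (Fin n) ℝ := ∑ i, ν i • A i

/-- ℳ_p = {Y ∈ ℝ^{n×p} : 𝒜(YYᵀ) = b}. -/
def MM {n m : ℕ} (A : Fin m → Matrix (Fin n) (Fin n) ℝ) (b : Fin m → ℝ) (p : ℕ) :
    Set (Matrix (Fin n) (Fin p) ℝ) := {Y | calA A (Y * Yᵀ) = b}

/-- 𝒞 = {X ∈ Sym(n,ℝ) : 𝒜(X) = b, X ⪰ 0}. -/
def CC {n m : ℕ} (A : Fin m → Matrix (Fin n) (Fin n) ℝ) (b : Fin m → ℝ) :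
    Set (Matrix (Fin n) (Fin n) ℝ) := {X | X.IsSymm ∧ calA A X = b ∧ X.PosSemidef}

/-- Gram matrix G(Y)ᵢⱼ = ⟨AᵢY, AⱼY⟩. -/
def gram {n m p : ℕ} (A : Fin m → Matrix (Fin n) (Fin n) ℝ) (Y : Matrix (Fin n) (Fin p) ℝ) :
    Matrix (Fin m) (Fin m) ℝ := Matrix.of fun i j => ip (A i * Y) (A j * Y)

/-- S(Y) = C − 𝒜*(G(Y)⁻¹ 𝒜(C Y Yᵀ)). -/
def Smat {n m p : ℕ} (A : Fin m → Matrix (Fin n) (Fin n) ℝ) (C : Matrix (Fin n) (Fin n) ℝ)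
    (Y : Matrix (Fin n) (Fin p) ℝ) : Matrix (Fin n) (Fin n) ℝ :=
  C - adjA A ((gram A Y)⁻¹ *ᵥ calA A (C * (Y * Yᵀ)))

/-- Frobenius norm. -/
def frob {a c : ℕ} (M : Matrix (Fin a) (Fin c) ℝ) : ℝ := Real.sqrt (∑ i, ∑ j, (M i j) ^ 2)


open scoped MatrixOrder in
theorem trace_mul_nonneg_of_posSemidef {n : ℕ} {S X : Matrix (Fin n) (Fin n) ℝ}
    (hS : S.PosSemidef) (hX : X.PosSemidef) : 0 ≤ trace (S * X) := by
  obtain ⟨B, rfl⟩ := CStarAlgebra.nonneg_iff_eq_star_mul_self.mp hX.nonneg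
  have h := (hS.mul_mul_conjTranspose_same B).trace_nonneg
  rwa [Matrix.mul_assoc, trace_mul_comm, Matrix.mul_assoc, ← star_eq_conjTranspose] at h

theorem ip_eq_sum {n p : ℕ} (U V : Matrix (Fin n) (Fin p) ℝ) :
    ip U V = ∑ i, ∑ j, U i j * V i j := by
  simp only [ip, trace, diag_apply, mul_apply, transpose_apply]
  exact Finset.sum_comm

theorem ip_le_frob_mul_frob {n p : ℕ} (U V : Matrix (Fin n) (Fin p) ℝ) :
    ip U V ≤ frob U * frob V := by
  rw [ip_eq_sum, frob, frob]
  simp only [← Fintype.sum_prod_type']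
  exact Real.sum_mul_le_sqrt_mul_sqrt _ _ _

theorem frob_eq_sqrt_trace {n p : ℕ} (Y : Matrix (Fin n) (Fin p) ℝ) :
    frob Y = √(trace (Y * Yᵀ)) := by
  simp only [frob, trace, diag_apply, mul_apply, transpose_apply, sq]

theorem adjA_mul_eq_sum {n m p : ℕ} (A : Fin m → Matrix (Fin n) (Fin n) ℝ) (ν : Fin m → ℝ)
    (Y : Matrix (Fin n) (Fin p) ℝ) : adjA A ν * Y = ∑ i, ν i • (A i * Y) := by
  simp [adjA, Matrix.sum_mul]

theorem trace_adjA_mul {n m : ℕ} (A : Fin m → Matrix (Fin n) (Fin n) ℝ) (ν : Fin m → ℝ)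
    (X : Matrix (Fin n) (Fin n) ℝ) : trace (adjA A ν * X) = ∑ i, ν i * calA A X i := by
  simp [adjA_mul_eq_sum, calA, trace_sum]

theorem gram_mulVec {n m p : ℕ} (A : Fin m → Matrix (Fin n) (Fin n) ℝ)
    (Y : Matrix (Fin n) (Fin p) ℝ) (ν : Fin m → ℝ) (i : Fin m) :
    (gram A Y *ᵥ ν) i = ip (A i * Y) (adjA A ν * Y) := by
  simp [adjA_mul_eq_sum, _root_.gram, mulVec, dotProduct, ip, Matrix.mul_sum, trace_sum, mul_comm]

theorem isUnit_gram {n m p : ℕ} {A : Fin m → Matrix (Fin n) (Fin n) ℝ}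
    {Y : Matrix (Fin n) (Fin p) ℝ} (h : LinearIndependent ℝ fun i => A i * Y) :
    IsUnit (gram A Y) := by
  rw [← mulVec_injective_iff_isUnit, ← coe_mulVecLin, ← LinearMap.ker_eq_bot,
    LinearMap.ker_eq_bot']
  intro ν hν
  have h0 (i : Fin m) : ip (A i * Y) (adjA A ν * Y) = 0 := by
    rw [← gram_mulVec, ← mulVecLin_apply, hν, Pi.zero_apply]
  have hself : ip (adjA A ν * Y) (adjA A ν * Y) = 0 := by
    nth_rewrite 1 [adjA_mul_eq_sum]
    simp only [ip] at h0 ⊢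
    simp [-transpose_mul, transpose_sum, Matrix.sum_mul, trace_sum, h0]
  have hz : adjA A ν * Y = 0 := by
    rw [← trace_conjTranspose_mul_self_eq_zero_iff, conjTranspose_eq_transpose_of_trivial]
    exact hself
  rw [adjA_mul_eq_sum] at hz
  exact funext (Fintype.linearIndependent_iff.mp h ν hz)

/-- The vector `G(Y)⁻¹ 𝒜(C Y Yᵀ)` solves the normal equations, so `S(Y) Y` is orthogonal to
every `Aᵢ Y`. -/
theorem ip_mul_Smat_mul_eq_zero {n m p : ℕ} {A : Fin m → Matrix (Fin n) (Fin n) ℝ}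
    (hA : ∀ i, (A i).IsSymm) (C : Matrix (Fin n) (Fin n) ℝ) {Y : Matrix (Fin n) (Fin p) ℝ}
    (h : LinearIndependent ℝ fun i => A i * Y) (i : Fin m) :
    ip (A i * Y) (Smat A C Y * Y) = 0 := by
  have hdet := (isUnit_iff_isUnit_det _).mp (isUnit_gram h)
  have hμ := gram_mulVec A Y ((gram A Y)⁻¹ *ᵥ calA A (C * (Y * Yᵀ))) i
  rw [mulVec_mulVec, mul_nonsing_inv _ hdet, one_mulVec] at hμ
  have hC : ip (A i * Y) (C * Y) = calA A (C * (Y * Yᵀ)) i := by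
    rw [ip, calA, transpose_mul, (hA i).eq, Matrix.mul_assoc, trace_mul_comm]
    simp only [Matrix.mul_assoc]
  rw [Smat, Matrix.sub_mul, ip, Matrix.mul_sub, trace_sub, ← ip, ← ip, hC, ← hμ, sub_self]

theorem ip_Smat_mul_self_eq_zero {n m p : ℕ} {A : Fin m → Matrix (Fin n) (Fin n) ℝ}
    (hA : ∀ i, (A i).IsSymm) (C : Matrix (Fin n) (Fin n) ℝ) {Y : Matrix (Fin n) (Fin p) ℝ}
    (h : LinearIndependent ℝ fun i => A i * Y) {ν : Fin m → ℝ} (hν : 1 = adjA A ν) :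
    ip Y (Smat A C Y * Y) = 0 := by
  have h0 := ip_mul_Smat_mul_eq_zero hA C h
  have hY : Y = ∑ i, ν i • (A i * Y) := by rw [← adjA_mul_eq_sum, ← hν, Matrix.one_mul]
  simp only [ip] at h0 ⊢
  nth_rewrite 1 [hY]
  simp [-transpose_mul, transpose_sum, Matrix.sum_mul, trace_sum, h0]

theorem trace_Smat_mul_sub {n m p : ℕ} {A : Fin m → Matrix (Fin n) (Fin n) ℝ}
    (C : Matrix (Fin n) (Fin n) ℝ) (Y : Matrix (Fin n) (Fin p) ℝ)
    {X X' : Matrix (Fin n) (Fin n) ℝ} (h : calA A X = calA A X') :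
    trace (Smat A C Y * X) - trace (Smat A C Y * X') = trace (C * X) - trace (C * X') := by
  simp only [Smat, Matrix.sub_mul, trace_sub, trace_adjA_mul, h]
  ring

theorem two_mul_gap_le {n m p : ℕ} {A : Fin m → Matrix (Fin n) (Fin n) ℝ}
    {C : Matrix (Fin n) (Fin n) ℝ} (hC : C.IsSymm) {b : Fin m → ℝ} {R : ℝ}
    (hRC : ∀ X ∈ CC A b, trace X ≤ R) {Y : Matrix (Fin n) (Fin p) ℝ} (hY : Y ∈ MM A b p)
    {εH : ℝ} (hεH : 0 ≤ εH)
    (hhess : (Smat A C Y + (εH / 2) • (1 : Matrix (Fin n) (Fin n) ℝ)).PosSemidef)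
    {X' : Matrix (Fin n) (Fin n) ℝ} (hX' : X' ∈ CC A b) :
    2 * (trace (Cᵀ * (Y * Yᵀ)) - trace (Cᵀ * X')) ≤ εH * R + 2 * ip Y (Smat A C Y * Y) := by
  have hpsd := trace_mul_nonneg_of_posSemidef hhess hX'.2.2
  rw [Matrix.add_mul, Matrix.smul_mul, Matrix.one_mul, trace_add, trace_smul, smul_eq_mul] at hpsd
  have hgap := trace_Smat_mul_sub C Y (hY.trans hX'.2.1.symm)
  have hip : ip Y (Smat A C Y * Y) = trace (Smat A C Y * (Y * Yᵀ)) := by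
    rw [ip, trace_mul_comm, Matrix.mul_assoc]
  have hR := mul_le_mul_of_nonneg_left (hRC X' hX') hεH
  rw [hC.eq]
  linarith

theorem frob_le_sqrt {n m p : ℕ} {A : Fin m → Matrix (Fin n) (Fin n) ℝ} {b : Fin m → ℝ} {R : ℝ}
    (hRC : ∀ X ∈ CC A b, trace X ≤ R) {Y : Matrix (Fin n) (Fin p) ℝ} (hY : Y ∈ MM A b p) :
    frob Y ≤ √R := by
  rw [frob_eq_sqrt_trace]
  refine Real.sqrt_le_sqrt (hRC _ ⟨by simp [IsSymm], hY, ?_⟩)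
  simpa using posSemidef_self_mul_conjTranspose Y

/-- Lemma 4 of the paper: approximate optimality gap bound. If
‖2S(Y)Y‖_F ≤ ε_g and S(Y) + (ε_H/2)Iₙ ⪰ 0, then for every X' ∈ 𝒞,
2(⟨C, YYᵀ⟩ − ⟨C, X'⟩) ≤ ε_H R + ε_g √R; and if Iₙ ∈ im 𝒜*, the sharper bound
2(⟨C, YYᵀ⟩ − ⟨C, X'⟩) ≤ ε_H R holds. -/
theorem stmt13 (n m p : ℕ) (hn : 1 ≤ n) (hm : 1 ≤ m) (hp : 1 ≤ p)
    (A : Fin m → Matrix (Fin n) (Fin n) ℝ) (hA : ∀ i, (A i).IsSymm)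
    (C : Matrix (Fin n) (Fin n) ℝ) (hC : C.IsSymm) (b : Fin m → ℝ)
    (hli : ∀ Y ∈ MM A b p, LinearIndependent ℝ (fun i => A i * Y))
    (R : ℝ) (hR : 0 ≤ R) (hRC : ∀ X ∈ CC A b, Matrix.trace X ≤ R)
    (Y : Matrix (Fin n) (Fin p) ℝ) (hY : Y ∈ MM A b p)
    (εg εH : ℝ) (hεg : 0 ≤ εg) (hεH : 0 ≤ εH)
    (hgrad : frob (2 • (Smat A C Y * Y)) ≤ εg)
    (hhess : (Smat A C Y + (εH / 2) • (1 : Matrix (Fin n) (Fin n) ℝ)).PosSemidef) :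
    (∀ X' ∈ CC A b,
      2 * (Matrix.trace (Cᵀ * (Y * Yᵀ)) - Matrix.trace (Cᵀ * X')) ≤
        εH * R + εg * Real.sqrt R) ∧
    ((∃ ν : Fin m → ℝ, (1 : Matrix (Fin n) (Fin n) ℝ) = adjA A ν) →
      ∀ X' ∈ CC A b,
        2 * (Matrix.trace (Cᵀ * (Y * Yᵀ)) - Matrix.trace (Cᵀ * X')) ≤ εH * R) := by
  have hlin := hli Y hY
  refine ⟨fun X' hX' => ?_, fun ⟨ν, hν⟩ X' hX' => ?_⟩
  · have hgap := two_mul_gap_le hC hRC hY hεH hhess hX'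
    have hcs := ip_le_frob_mul_frob Y (2 • (Smat A C Y * Y))
    have htwo : ip Y (2 • (Smat A C Y * Y)) = 2 * ip Y (Smat A C Y * Y) := by
      rw [ip, ip, Matrix.mul_smul, trace_smul, nsmul_eq_mul, Nat.cast_ofNat]
    have hprod : frob Y * frob (2 • (Smat A C Y * Y)) ≤ √R * εg :=
      mul_le_mul (frob_le_sqrt hRC hY) hgrad (Real.sqrt_nonneg _) (Real.sqrt_nonneg _)
    linarith
  · have hgap := two_mul_gap_le hC hRC hY hεH hhess hX'
    rwa [ip_Smat_mul_self_eq_zero hA C hlin hν, mul_zero, add_zero] at hgap
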